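/- Let H be a real Hilbert space and D ⊆ H a symmetric set of unit vectors whose closed linear span is dense in H. Let 0 < α ≤ 1 and let f ∈ A₁(D), i.e., f lies in the closed convex hull of D. Let (T_m)_{m≥0} be the Power–Relaxed Greedy Algorithm iterates with exponent α: T₀ = 0; T₁ = ⟨f, g₁⟩ g₁ where g₁ ∈ D satisfies ⟨f, g₁⟩ = sup_{g ∈ D} ⟨f, g⟩; and for m ≥ 2, T_m = (1 − 1/m^α) T_{m−1} + (1/m^α) g_m, where g_m ∈ D satisfies ⟨f − T_{m−1}, g_m⟩ = sup_{g ∈ D} ⟨f − T_{m−1}, g⟩. Then for every m ≥ 1, ‖f − T_m‖² ≤ 4/m^α. -/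

import Mathlib

open RealInnerProductSpace

/-- A point of the closed convex hull of `D` has inner product with `r` at most the supremum of
the inner products of `r` with elements of `D`. -/
theorem inner_le_sSup_of_mem_closure_convexHull {H : Type*} [NormedAddCommGroup H]
    [InnerProductSpace ℝ H] {D : Set H} (hD : ∀ g ∈ D, ‖g‖ = 1) {f : H}
    (hf : f ∈ closure (convexHull ℝ D)) (r : H) :
    ⟪r, f⟫ ≤ sSup ((fun x => ⟪r, x⟫) '' D) := by
  have hbdd : BddAbove ((fun x => ⟪r, x⟫) '' D) := by
    refine ⟨‖r‖, ?_⟩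
    rintro _ ⟨x, hx, rfl⟩
    simpa [hD x hx] using real_inner_le_norm r x
  have hconv : Convex ℝ {x : H | ⟪r, x⟫ ≤ sSup ((fun x => ⟪r, x⟫) '' D)} :=
    convex_halfSpace_le (innerSL ℝ r).toLinearMap.isLinear _
  have hclosed : IsClosed {x : H | ⟪r, x⟫ ≤ sSup ((fun x => ⟪r, x⟫) '' D)} :=
    isClosed_le (by fun_prop) continuous_const
  exact closure_minimal
    (convexHull_min (fun x hx => le_csSup hbdd (Set.mem_image_of_mem _ hx)) hconv) hclosed hf

theorem norm_le_one_of_mem_closure_convexHull {H : Type*} [NormedAddCommGroup H]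
    [InnerProductSpace ℝ H] {D : Set H} (hD : ∀ g ∈ D, ‖g‖ = 1) {f : H}
    (hf : f ∈ closure (convexHull ℝ D)) : ‖f‖ ≤ 1 := by
  have h : f ∈ Metric.closedBall (0 : H) 1 :=
    closure_minimal (convexHull_min (fun x hx => by simp [hD x hx]) (convex_closedBall _ _))
      Metric.isClosed_closedBall hf
  simpa using h

/-- One relaxation step with weight `b` towards a vector `g` at least as correlated with the
residual `f - t` as `f` is. -/
theorem norm_sub_relaxation_sq_le {H : Type*} [NormedAddCommGroup H] [InnerProductSpace ℝ H]
    {f t g : H} {b : ℝ} (hb0 : 0 ≤ b) (hb1 : b ≤ 1) (hg : ⟪f - t, f⟫ ≤ ⟪f - t, g⟫) :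
    ‖f - ((1 - b) • t + b • g)‖ ^ 2 ≤ (1 - b) ^ 2 * ‖f - t‖ ^ 2 + b ^ 2 * ‖f - g‖ ^ 2 := by
  have hdecomp : f - ((1 - b) • t + b • g) = (1 - b) • (f - t) + b • (f - g) := by module
  have hinner : ⟪f - t, f - g⟫ ≤ 0 := by rw [inner_sub_right]; linarith
  have hprod : (1 - b) * b * ⟪f - t, f - g⟫ ≤ 0 :=
    mul_nonpos_of_nonneg_of_nonpos (mul_nonneg (by linarith) hb0) hinner
  rw [hdecomp, norm_add_sq_real, norm_smul, norm_smul, real_inner_smul_left,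
    real_inner_smul_right, mul_pow, mul_pow, Real.norm_eq_abs, Real.norm_eq_abs, sq_abs, sq_abs]
  linarith

/-- The bound `4 / n ^ α` is preserved by the recursion `a ↦ (1 - b) ^ 2 * a + 4 * b ^ 2` with
`b = 1 / (n + 1) ^ α`. -/
theorem relaxation_recursion_le {α x a : ℝ} (hα0 : 0 < α) (hα1 : α ≤ 1) (hx : 1 ≤ x)
    (ha : a ≤ 4 / x ^ α) :
    (1 - 1 / (x + 1) ^ α) ^ 2 * a + (1 / (x + 1) ^ α) ^ 2 * 4 ≤ 4 / (x + 1) ^ α := by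
  have hsub : (x + 1) ^ α ≤ x ^ α + 1 := by
    simpa using Real.rpow_add_le_add_rpow (by linarith : 0 ≤ x) zero_le_one hα0.le hα1
  have hp : 0 < x ^ α := Real.rpow_pos_of_pos (by linarith) α
  have hq : 1 ≤ (x + 1) ^ α := Real.one_le_rpow (by linarith) hα0.le
  set p := x ^ α
  set q := (x + 1) ^ α
  have hq0 : 0 < q := by linarith
  calc (1 - 1 / q) ^ 2 * a + (1 / q) ^ 2 * 4
      ≤ (1 - 1 / q) ^ 2 * (4 / p) + (1 / q) ^ 2 * 4 := by gcongr
    _ = 4 / q - 4 * (q - 1) * (p + 1 - q) / (p * q ^ 2) := by field_simp; ring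
    _ ≤ 4 / q := by
      have : 0 ≤ 4 * (q - 1) * (p + 1 - q) / (p * q ^ 2) :=
        div_nonneg (mul_nonneg (by linarith) (by linarith)) (by positivity)
      linarith

/-- Convergence of the Power-Relaxed Greedy Algorithm for `0 < α ≤ 1`: with
`D` a symmetric dictionary (unit vectors with dense closed linear span) in a
real Hilbert space and `f ∈ A₁(D)` (the closed convex hull of `D`), the PRGA
iterates `T_m` (with `T₀ = 0`, `T₁ = ⟨f, g₁⟩g₁` for a greedily chosen `g₁`,
and `T_m = (1 - 1/m^α)T_{m-1} + (1/m^α)g_m` for `m ≥ 2` with greedily chosen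
`g_m`) satisfy `‖f - T_m‖² ≤ 4/m^α` for every `m ≥ 1`. -/
theorem stmt_15 {H : Type*} [NormedAddCommGroup H] [InnerProductSpace ℝ H]
    [CompleteSpace H]
    (α : ℝ) (hα0 : 0 < α) (hα1 : α ≤ 1)
    (D : Set H) (hDunit : ∀ g ∈ D, ‖g‖ = 1) (hDsym : ∀ g ∈ D, -g ∈ D)
    (hDdense : Dense (↑(Submodule.span ℝ D) : Set H))
    (f : H) (hf : f ∈ closure (convexHull ℝ D))
    (T g : ℕ → H)
    (hT0 : T 0 = 0)
    (hg1 : g 1 ∈ D ∧ ⟪f, g 1⟫ = sSup ((fun x => ⟪f, x⟫) '' D))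
    (hT1 : T 1 = ⟪f, g 1⟫ • g 1)
    (hgm : ∀ m : ℕ, 2 ≤ m → g m ∈ D ∧
      ⟪f - T (m - 1), g m⟫ = sSup ((fun x => ⟪f - T (m - 1), x⟫) '' D))
    (hTm : ∀ m : ℕ, 2 ≤ m →
      T m = (1 - 1 / (m : ℝ) ^ α) • T (m - 1) + (1 / (m : ℝ) ^ α) • g m) :
    ∀ m : ℕ, 1 ≤ m → ‖f - T m‖ ^ 2 ≤ 4 / (m : ℝ) ^ α := by
  have hfnorm := norm_le_one_of_mem_closure_convexHull hDunit hf
  intro m hm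
  induction m, hm using Nat.le_induction with
  | base =>
    have hsq : ‖f - T 1‖ ^ 2 = ‖f‖ ^ 2 - ⟪f, g 1⟫ ^ 2 := by
      rw [hT1, norm_sub_sq_real, norm_smul, real_inner_smul_right, mul_pow, Real.norm_eq_abs,
        sq_abs, hDunit _ hg1.1]
      ring
    rw [hsq]
    norm_num
    nlinarith [norm_nonneg f, sq_nonneg ⟪f, g 1⟫]
  | succ n hn ih =>
    obtain ⟨hgD, hgsup⟩ := hgm (n + 1) (by omega)
    have hx : (1 : ℝ) ≤ n := by exact_mod_cast hn
    have hq : 1 ≤ ((n : ℝ) + 1) ^ α := Real.one_le_rpow (by linarith) hα0.le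
    have hdist : ‖f - g (n + 1)‖ ^ 2 ≤ 4 := by
      have h := norm_sub_le f (g (n + 1))
      rw [hDunit _ hgD] at h
      nlinarith [norm_nonneg (f - g (n + 1))]
    rw [hTm (n + 1) (by omega)]
    simp only [Nat.add_sub_cancel, Nat.cast_add, Nat.cast_one] at hgsup ⊢
    calc _ ≤ _ := norm_sub_relaxation_sq_le (by positivity)
          (div_le_one_of_le₀ hq (by positivity))
          ((inner_le_sSup_of_mem_closure_convexHull hDunit hf _).trans_eq hgsup.symm)
      _ ≤ (1 - 1 / ((n : ℝ) + 1) ^ α) ^ 2 * ‖f - T n‖ ^ 2 +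
          (1 / ((n : ℝ) + 1) ^ α) ^ 2 * 4 := by gcongr
      _ ≤ _ := relaxation_recursion_le hα0 hα1 hx ih
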